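/- If f ∈ Mould(m) and g ∈ Mould(n) are vegetal, then f ≻ g and f ≺ g are vegetal elements of Mould(m+n). -/

import Mathlib

/-!
Formalization of results from "The anticyclic operad of moulds" (F. Chapoton).

`Mould n` is the field of rational functions in variables `u 1, …, u n` with
rational coefficients, realized as a subfield of the fraction field `K` of
`ℚ[X 0, X 1, X 2, …]`.  The variable `u 0 = X 0` is reserved as an auxiliary
variable (the parameter `t` or `λ`).  Substitution of rational functions for
the variables is realized by the (partial, well-defined) function `msub`.
-/

noncomputable section
namespace MouldOperad

open MvPolynomial Finset

attribute [local instance] Classical.propDecidable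
set_option synthInstance.maxHeartbeats 1000000

abbrev MPoly : Type := MvPolynomial ℕ ℚ
abbrev K : Type := FractionRing MPoly

/-- the variable `u i` (1-based; index `0` is auxiliary). -/
def u (i : ℕ) : K := algebraMap MPoly K (X i)

/-- `u_{i..j} = u_i + u_{i+1} + ⋯ + u_j`. -/
def usum (i j : ℕ) : K := ∑ k ∈ Finset.Icc i j, u k

/-- evaluation of polynomials, sending the variable `X k` to `v k`. -/
def pev (v : ℕ → K) : MPoly →+* K :=
  eval₂Hom ((algebraMap MPoly K).comp (C : ℚ →+* MPoly)) v

/-- Substitution of the rational functions `v k` for the variables of `f ∈ K`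
(the induced field homomorphism): it takes the canonical value whenever `f` has
a fraction representation whose denominator does not vanish under the
substitution (this value does not depend on the representation), and the junk
value `0` otherwise. -/
def msub (v : ℕ → K) (f : K) : K :=
  if h : ∃ w : K, ∃ p q : MPoly, q ≠ 0 ∧
      f = algebraMap MPoly K p / algebraMap MPoly K q ∧
      pev v q ≠ 0 ∧ w = pev v p / pev v q
  then h.choose else 0

/-- the field `Mould n` of rational functions in `u 1, …, u n`. -/
def Mould (n : ℕ) : Subfield K :=
  Subfield.closure {x : K | ∃ i, 1 ≤ i ∧ i ≤ n ∧ x = u i}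

/-- substitution used for `f` in `f ∘_i g`, where `g` has degree `n`:
`f(u_1, …, u_{i-1}, u_{i..i+n-1}, u_{i+n}, …, u_{m+n-1})`. -/
def compSubF (n i : ℕ) : ℕ → K := fun k =>
  if k < i then u k else if k = i then usum i (i + n - 1) else u (k + n - 1)

/-- substitution used for `g` in `f ∘_i g` : `g(u_i, …, u_{i+n-1})`. -/
def compSubG (i : ℕ) : ℕ → K := fun k => u (k + i - 1)

/-- the composition `f ∘_i g`, where `g` has degree `n` (1-based index `i`). -/
def comp (n i : ℕ) (f g : K) : K :=
  usum i (i + n - 1) * msub (compSubF n i) f * msub (compSubG i) g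

/-- the push `τ` on `Mould n`: `τ(f)(u_1,…,u_n) = f(-u_{1..n}, u_1, …, u_{n-1})`. -/
def push (n : ℕ) (f : K) : K :=
  msub (fun k => if k = 1 then -(usum 1 n) else if k ≤ n then u (k - 1) else u k) f

/-- a permutation of `Fin n` as a (1-based) permutation of `ℕ`. -/
def permExt (n : ℕ) (σ : Equiv.Perm (Fin n)) : ℕ → ℕ := fun k =>
  if h : 1 ≤ k ∧ k ≤ n then ((σ ⟨k - 1, by omega⟩ : Fin n) : ℕ) + 1 else k

/-- `f ∈ Mould n` is alternal : for each `1 ≤ i ≤ n-1`, the sum of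
`f(u_{σ(1)}, …, u_{σ(n)})` over the shuffles `σ ∈ Sh(i, n-i)` vanishes. -/
def IsAlternal (n : ℕ) (f : K) : Prop :=
  ∀ i : ℕ, 1 ≤ i → i ≤ n - 1 →
    ∑ σ ∈ Finset.univ.filter (fun σ : Equiv.Perm (Fin n) =>
        (∀ a b : Fin n, a < b → (b : ℕ) < i → σ a < σ b) ∧
        (∀ a b : Fin n, a < b → i ≤ (a : ℕ) → σ a < σ b)),
      msub (fun k => u (permExt n σ k)) f = 0

/-- `f ∈ Mould n` is vegetal :
`u_1⋯u_n · Σ_{σ ∈ S_n} f(t·u_{σ(1)}, …, t·u_{σ(n)}) = n! · f(t,…,t)`,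
where the auxiliary variable `t` is `u 0`. -/
def IsVegetal (n : ℕ) (f : K) : Prop :=
  (∏ k ∈ Finset.Icc 1 n, u k) *
      ∑ σ : Equiv.Perm (Fin n), msub (fun k => u 0 * u (permExt n σ k)) f =
    (n.factorial : K) * msub (fun _ => u 0) f

/-- `f ∈ Mould n` is homogeneous of weight `d` : `f(λu_1,…,λu_n) = λ^d·f`,
where the auxiliary variable `λ` is `u 0`. -/
def IsHomogeneousOfWeight (n : ℕ) (d : ℤ) (f : K) : Prop :=
  msub (fun k => if 1 ≤ k ∧ k ≤ n then u 0 * u k else u k) f = u 0 ^ d * f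

/-- shift substitution : `g(u_{m+1}, …, u_{m+n})`. -/
def shiftSub (m : ℕ) : ℕ → K := fun k => u (k + m)

/-- `f ≻ g` for `f ∈ Mould m`, `g ∈ Mould n`. -/
def dsucc (m n : ℕ) (f g : K) : K :=
  f * msub (shiftSub m) g * usum (m + 1) (m + n) / usum 1 (m + n)

/-- `f ≺ g` for `f ∈ Mould m`, `g ∈ Mould n`. -/
def dprec (m n : ℕ) (f g : K) : K :=
  f * msub (shiftSub m) g * usum 1 m / usum 1 (m + n)

/-- `MU(f,g)` for `f ∈ Mould m`. -/
def MU (m : ℕ) (f g : K) : K := f * msub (shiftSub m) g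

/-- `LIMU(f,g) = MU(f,g) - MU(g,f)` for `f ∈ Mould m`, `g ∈ Mould n`. -/
def LIMU (m n : ℕ) (f g : K) : K := MU m f g - MU n g f

/-- the pre-Lie product `f ↶ g` for `f ∈ Mould m`, `g ∈ Mould n`. -/
def preLieCurve (m n : ℕ) (f g : K) : K :=
  f * msub (shiftSub m) g * usum (m + 1) (m + n) / usum 1 (m + n)
    - g * msub (shiftSub n) f * usum 1 n / usum 1 (m + n)

/-- the pre-Lie product `f ∘ g = Σ_{i=1}^m f ∘_i g`, `f ∈ Mould m`, `g ∈ Mould n`. -/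
def preLieComp (m n : ℕ) (f g : K) : K := ∑ i ∈ Finset.Icc 1 m, comp n i f g

/-- `H_n = ∏_{1 ≤ i ≤ j ≤ n} u_{i..j}`. -/
def Hprod (n : ℕ) : K := ∏ i ∈ Finset.Icc 1 n, ∏ j ∈ Finset.Icc i n, usum i j

/-- `x` is (the image of) a polynomial in `u_1, …, u_n`. -/
def IsPolyIn (n : ℕ) (x : K) : Prop :=
  ∃ p : MPoly, (∀ k ∈ p.vars, 1 ≤ k ∧ k ≤ n) ∧ x = algebraMap MPoly K p

/-- `f ∈ Mould n` has nice poles: it is a polynomial divided by a product of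
powers of the linear forms `u_{i..j}`, `1 ≤ i ≤ j ≤ n`. -/
def HasNicePoles (n : ℕ) (f : K) : Prop :=
  ∃ (P : MPoly) (e : ℕ → ℕ → ℕ),
    (∀ k ∈ P.vars, 1 ≤ k ∧ k ≤ n) ∧
    f = algebraMap MPoly K P /
        ∏ i ∈ Finset.Icc 1 n, ∏ j ∈ Finset.Icc i n, usum i j ^ e i j

/-- the Over product `f / Y`, `f ∈ Mould n`. -/
def overY (n : ℕ) (f : K) : K := f / usum 1 (n + 1)

/-- the Under product `Y \ f`, `f ∈ Mould n`. -/
def underY (n : ℕ) (f : K) : K := msub (fun k => u (k + 1)) f / usum 1 (n + 1)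

/-- `ARIT(f,g) = f ∘ (g/Y) - f ∘ (Y\g)` for `f ∈ Mould m`, `g ∈ Mould n`. -/
def ARIT (m n : ℕ) (f g : K) : K :=
  preLieComp m (n + 1) f (overY n g) - preLieComp m (n + 1) f (underY n g)

/-- `ARI(f,g) = ARIT(f,g) - ARIT(g,f) + LIMU(f,g)`, `f ∈ Mould m`, `g ∈ Mould n`. -/
def ARI (m n : ℕ) (f g : K) : K := ARIT m n f g - ARIT n m g f + LIMU m n f g

/-- evaluation of polynomials into `RatFunc K` (rational functions in `t` over `K`). -/
def pevR (v : ℕ → RatFunc K) : MPoly →+* RatFunc K :=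
  eval₂Hom ((RatFunc.C).comp ((algebraMap MPoly K).comp (C : ℚ →+* MPoly))) v

/-- substitution into `RatFunc K`. -/
def msubR (v : ℕ → RatFunc K) (f : K) : RatFunc K :=
  if h : ∃ w : RatFunc K, ∃ p q : MPoly, q ≠ 0 ∧
      f = algebraMap MPoly K p / algebraMap MPoly K q ∧
      pevR v q ≠ 0 ∧ w = pevR v p / pevR v q
  then h.choose else 0

/-- residue at `t = 0`: the coefficient of `t⁻¹` in the Laurent expansion at `0`. -/
def res (r : RatFunc K) : K := (↑r : LaurentSeries K).coeff (-1)

/-- the mould derivative `∂f` for `f ∈ Mould m`: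
`∂f(u_1,…,u_{m-1}) = Σ_{j=1}^m Res_{t=0} f(u_1,…,u_{j-1},t,u_j,…,u_{m-1})`,
where `f(u_1,…,u_{j-1},t,u_j,…,u_{m-1})` is viewed in `RatFunc K`. -/
def mderiv (m : ℕ) (f : K) : K :=
  ∑ j ∈ Finset.Icc 1 m,
    res (msubR (fun k =>
      if k < j then RatFunc.C (u k)
      else if k = j then RatFunc.X
      else RatFunc.C (u (k - 1))) f)

/-- evaluation of polynomials into `ℚ(x)`, sending every variable to `1/x`. -/
def pevX : MPoly →+* RatFunc ℚ :=
  eval₂Hom (RatFunc.C : ℚ →+* RatFunc ℚ) (fun _ => (RatFunc.X)⁻¹)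

/-- the substitution `u_i ↦ 1/x`, landing in `ℚ(x)`. -/
def evalx (f : K) : RatFunc ℚ :=
  if h : ∃ w : RatFunc ℚ, ∃ p q : MPoly, q ≠ 0 ∧
      f = algebraMap MPoly K p / algebraMap MPoly K q ∧
      pevX q ≠ 0 ∧ w = pevX p / pevX q
  then h.choose else 0

/-- the derivative `d/dx` on `ℚ(x)`. -/
def rfDeriv (r : RatFunc ℚ) : RatFunc ℚ :=
  (algebraMap (Polynomial ℚ) (RatFunc ℚ) (Polynomial.derivative r.num) *
      algebraMap (Polynomial ℚ) (RatFunc ℚ) r.denom -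
    algebraMap (Polynomial ℚ) (RatFunc ℚ) r.num *
      algebraMap (Polynomial ℚ) (RatFunc ℚ) (Polynomial.derivative r.denom)) /
    algebraMap (Polynomial ℚ) (RatFunc ℚ) r.denom ^ 2

/-- `f` is regular under the substitution `v`: some denominator of `f` survives it. -/
def RegularAt (v : ℕ → K) (f : K) : Prop :=
  ∃ p q : MPoly, pev v q ≠ 0 ∧ f = algebraMap MPoly K p / algebraMap MPoly K q

theorem algebraMap_MPoly_injective : Function.Injective (algebraMap MPoly K) :=
  IsFractionRing.injective MPoly K

theorem algebraMap_MPoly_ne_zero {q : MPoly} (hq : q ≠ 0) : algebraMap MPoly K q ≠ 0 := by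
  rwa [Ne, map_eq_zero_iff _ algebraMap_MPoly_injective]

theorem ne_zero_of_pev_ne_zero {v : ℕ → K} {q : MPoly} (hq : pev v q ≠ 0) : q ≠ 0 := by
  rintro rfl
  exact hq (map_zero _)

theorem algebraMap_ne_zero_of_pev_ne_zero {v : ℕ → K} {q : MPoly} (hq : pev v q ≠ 0) :
    algebraMap MPoly K q ≠ 0 :=
  algebraMap_MPoly_ne_zero (ne_zero_of_pev_ne_zero hq)

@[simp]
theorem pev_X (v : ℕ → K) (i : ℕ) : pev v (X i) = v i := by
  simp [pev]

theorem mpoly_ringHom_ext {R : Type*} [CommRing R] {φ ψ : MPoly →+* R}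
    (h : ∀ i, φ (X i) = ψ (X i)) : φ = ψ :=
  MvPolynomial.ringHom_ext' (RingHom.ext_rat _ _) h

theorem mpoly_ringHom_eq_of_mem_supported {R : Type*} [CommRing R] {φ ψ : MPoly →+* R} {s : Set ℕ}
    (h : ∀ i ∈ s, φ (X i) = ψ (X i)) {p : MPoly} (hp : p ∈ supported ℚ s) : φ p = ψ p := by
  induction hp using Algebra.adjoin_induction with
  | mem x hx => obtain ⟨i, hi, rfl⟩ := hx; exact h i hi
  | algebraMap r =>
    exact RingHom.congr_fun
      (RingHom.ext_rat (φ.comp (algebraMap ℚ MPoly)) (ψ.comp (algebraMap ℚ MPoly))) r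
  | add x y _ _ hx hy => rw [map_add, map_add, hx, hy]
  | mul x y _ _ hx hy => rw [map_mul, map_mul, hx, hy]

theorem msub_div {v : ℕ → K} {p q : MPoly} (hq : pev v q ≠ 0) :
    msub v (algebraMap MPoly K p / algebraMap MPoly K q) = pev v p / pev v q := by
  have h : ∃ w : K, ∃ p' q' : MPoly, q' ≠ 0 ∧
      algebraMap MPoly K p / algebraMap MPoly K q =
        algebraMap MPoly K p' / algebraMap MPoly K q' ∧
      pev v q' ≠ 0 ∧ w = pev v p' / pev v q' :=
    ⟨_, p, q, ne_zero_of_pev_ne_zero hq, rfl, hq, rfl⟩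
  rw [msub, dif_pos h]
  obtain ⟨p', q', -, heq, hq', hw⟩ := h.choose_spec
  rw [hw]
  rw [div_eq_div_iff (algebraMap_ne_zero_of_pev_ne_zero hq)
    (algebraMap_ne_zero_of_pev_ne_zero hq'), ← map_mul, ← map_mul] at heq
  have := congrArg (pev v) (algebraMap_MPoly_injective heq)
  rw [map_mul, map_mul] at this
  rw [div_eq_div_iff hq' hq, this]

theorem msub_of_not_regularAt {v : ℕ → K} {f : K} (h : ¬ RegularAt v f) : msub v f = 0 := by
  rw [msub, dif_neg]
  rintro ⟨-, p, q, -, hf, hq, -⟩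
  exact h ⟨p, q, hq, hf⟩

theorem msub_algebraMap (v : ℕ → K) (p : MPoly) : msub v (algebraMap MPoly K p) = pev v p := by
  have := msub_div (v := v) (p := p) (q := 1) (by simp)
  simpa using this

theorem RegularAt.mul {v : ℕ → K} {f g : K} (hf : RegularAt v f) (hg : RegularAt v g) :
    RegularAt v (f * g) := by
  obtain ⟨p, q, hq, rfl⟩ := hf
  obtain ⟨r, s, hs, rfl⟩ := hg
  exact ⟨p * r, q * s, by rw [map_mul]; exact mul_ne_zero hq hs, by
    rw [map_mul, map_mul, div_mul_div_comm]⟩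

theorem msub_mul {v : ℕ → K} {f g : K} (hf : RegularAt v f) (hg : RegularAt v g) :
    msub v (f * g) = msub v f * msub v g := by
  obtain ⟨p, q, hq, rfl⟩ := hf
  obtain ⟨r, s, hs, rfl⟩ := hg
  rw [msub_div hq, msub_div hs, div_mul_div_comm, ← map_mul, ← map_mul, div_mul_div_comm,
    ← map_mul, ← map_mul, msub_div]
  rw [map_mul]
  exact mul_ne_zero hq hs

/-- Substitution commutes with field endomorphisms, also where it takes its junk value. -/
theorem map_msub (θ : K →+* K) (v : ℕ → K) (f : K) :
    θ (msub v f) = msub (fun k => θ (v k)) f := by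
  have key (p : MPoly) : pev (fun k => θ (v k)) p = θ (pev v p) :=
    RingHom.congr_fun (mpoly_ringHom_ext (φ := pev fun k => θ (v k)) (ψ := θ.comp (pev v))
      fun i => by simp) p
  by_cases h : RegularAt v f
  · obtain ⟨p, q, hq, rfl⟩ := h
    rw [msub_div hq, msub_div (by rwa [key, Ne, map_eq_zero]), map_div₀, key, key]
  · rw [msub_of_not_regularAt h, map_zero, msub_of_not_regularAt]
    rintro ⟨p, q, hq, hf⟩
    rw [key, Ne, map_eq_zero] at hq
    exact h ⟨p, q, hq, hf⟩

/-- The field endomorphism of `K` that renames the variables along an injection. -/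
def renameHom {ι : ℕ → ℕ} (hι : Function.Injective ι) : K →+* K :=
  IsFractionRing.lift (A := MPoly) (g := (algebraMap MPoly K).comp (rename ι : MPoly →ₐ[ℚ] MPoly))
    (algebraMap_MPoly_injective.comp (rename_injective ι hι))

theorem renameHom_u {ι : ℕ → ℕ} (hι : Function.Injective ι) (i : ℕ) :
    renameHom hι (u i) = u (ι i) := by
  simp [renameHom, u]

theorem pev_u (p : MPoly) (ι : ℕ → ℕ) :
    pev (fun k => u (ι k)) p = algebraMap MPoly K (rename ι p) :=
  RingHom.congr_fun (mpoly_ringHom_ext (φ := pev fun k => u (ι k))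
    (ψ := (algebraMap MPoly K).comp (rename ι : MPoly →ₐ[ℚ] MPoly).toRingHom)
      fun i => by simp [u]) p

/-- The rational functions in the variables `u i`, `i ∈ s`, as fractions of polynomials. -/
def IsFracIn (s : Set ℕ) (f : K) : Prop :=
  ∃ p ∈ supported ℚ s, ∃ q ∈ supported ℚ s, q ≠ 0 ∧
    f = algebraMap MPoly K p / algebraMap MPoly K q

theorem isFracIn_of_mem_Mould {n : ℕ} {f : K} (hf : f ∈ Mould n) :
    IsFracIn (Set.Icc 1 n) f := by
  induction hf using Subfield.closure_induction with
  | mem x hx =>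
    obtain ⟨i, h1, h2, rfl⟩ := hx
    exact ⟨X i, X_mem_supported.2 ⟨h1, h2⟩, 1, one_mem _, one_ne_zero, by simp [u]⟩
  | one => exact ⟨1, one_mem _, 1, one_mem _, one_ne_zero, by simp⟩
  | add x y _ _ hx hy =>
    obtain ⟨p, hp, q, hq, hq0, rfl⟩ := hx
    obtain ⟨r, hr, s, hs, hs0, rfl⟩ := hy
    refine ⟨p * s + q * r, add_mem (mul_mem hp hs) (mul_mem hq hr), q * s, mul_mem hq hs,
      mul_ne_zero hq0 hs0, ?_⟩
    rw [div_add_div _ _ (algebraMap_MPoly_ne_zero hq0) (algebraMap_MPoly_ne_zero hs0)]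
    simp only [map_add, map_mul]
  | neg x _ hx =>
    obtain ⟨p, hp, q, hq, hq0, rfl⟩ := hx
    exact ⟨-p, neg_mem hp, q, hq, hq0, by rw [map_neg, neg_div]⟩
  | inv x _ hx =>
    obtain ⟨p, hp, q, hq, hq0, rfl⟩ := hx
    by_cases hp0 : p = 0
    · exact ⟨0, zero_mem _, 1, one_mem _, one_ne_zero, by simp [hp0]⟩
    · exact ⟨q, hq, p, hp, hp0, by rw [inv_div]⟩
  | mul x y _ _ hx hy =>
    obtain ⟨p, hp, q, hq, hq0, rfl⟩ := hx
    obtain ⟨r, hr, s, hs, hs0, rfl⟩ := hy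
    exact ⟨p * r, mul_mem hp hr, q * s, mul_mem hq hs, mul_ne_zero hq0 hs0, by
      rw [map_mul, map_mul, div_mul_div_comm]⟩

/-- On `IsFracIn s` functions, regular substitutions only depend on the values at `s`. -/
theorem msub_congr {s : Set ℕ} {f : K} (hf : IsFracIn s f) {v w : ℕ → K}
    (h : ∀ i ∈ s, v i = w i) (hv : ∀ q ∈ supported ℚ s, q ≠ 0 → pev v q ≠ 0) :
    msub v f = msub w f := by
  obtain ⟨p, hp, q, hq, hq0, rfl⟩ := hf
  have key {p : MPoly} (hp : p ∈ supported ℚ s) : pev w p = pev v p :=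
    mpoly_ringHom_eq_of_mem_supported (fun i hi => by simp [h i hi]) hp
  rw [msub_div (hv q hq hq0), msub_div (by rw [key hq]; exact hv q hq hq0), key hp, key hq]

theorem IsFracIn.regularAt {s : Set ℕ} {f : K} (hf : IsFracIn s f) {v : ℕ → K}
    (hv : ∀ q ∈ supported ℚ s, q ≠ 0 → pev v q ≠ 0) : RegularAt v f := by
  obtain ⟨p, hp, q, hq, hq0, rfl⟩ := hf
  exact ⟨p, q, hv q hq hq0, rfl⟩

/-- The substitution `u i ↦ t * u (ι i)`, with `ι` injective and avoiding the index of `t`,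
kills no nonzero polynomial. -/
theorem pev_scaled_ne_zero {s : Set ℕ} {ι : ℕ → ℕ} (hι : Set.InjOn ι s)
    (h0 : ∀ i ∈ s, ι i ≠ 0) {q : MPoly} (hq : q ∈ supported ℚ s) (hq0 : q ≠ 0) :
    pev (fun k => u 0 * u (ι k)) q ≠ 0 := by
  obtain ⟨τ, hτ⟩ : ∃ τ : MPoly →+* MPoly, ∀ i, τ (X i) = X 0 * X (ι i) :=
    ⟨(aeval fun k => (X 0 * X (ι k) : MPoly)).toRingHom, fun i => by simp⟩
  obtain ⟨ρ, hρ⟩ : ∃ ρ : MPoly →+* MPoly, ∀ i,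
      ρ (X i) = if i = 0 then 1 else X (Function.invFunOn ι s i) :=
    ⟨(aeval fun k => if k = 0 then (1 : MPoly) else X (Function.invFunOn ι s k)).toRingHom,
      fun i => by simp⟩
  have h1 : pev (fun k => u 0 * u (ι k)) q = algebraMap MPoly K (τ q) :=
    RingHom.congr_fun (mpoly_ringHom_ext (φ := pev fun k => u 0 * u (ι k))
      (ψ := (algebraMap MPoly K).comp τ) fun i => by simp [u, hτ]) q
  have h2 : ρ (τ q) = q :=
    mpoly_ringHom_eq_of_mem_supported (φ := ρ.comp τ) (ψ := RingHom.id _)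
      (fun i hi => by simp [hρ, hτ, h0 i hi, hι.leftInvOn_invFunOn hi]) hq
  rw [h1]
  refine algebraMap_MPoly_ne_zero fun h => hq0 ?_
  rw [← h2, h, map_zero]

theorem exists_eval_ne_zero {q : MPoly} (hq : q ≠ 0) : ∃ x : ℕ → ℚ, eval x q ≠ 0 := by
  by_contra! h
  exact hq (MvPolynomial.funext fun x => by simp [h x])

/-- If a product of nonzero functions in disjoint sets of variables is regular on the diagonal,
then so is each factor. -/
theorem RegularAt.of_mul_left {s : Set ℕ} {f g : K} (hf : IsFracIn s f) (hg : IsFracIn sᶜ g)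
    (hg0 : g ≠ 0) (h : RegularAt (fun _ => u 0) (f * g)) : RegularAt (fun _ => u 0) f := by
  obtain ⟨a, ha, b, hb, hb0, rfl⟩ := hf
  obtain ⟨r, hr, c, hc, hc0, rfl⟩ := hg
  obtain ⟨p, q, hq, heq⟩ := h
  have hr0 : r ≠ 0 := by
    rintro rfl
    simp at hg0
  have hpoly : a * r * q = p * (b * c) := by
    rw [div_mul_div_comm, ← map_mul, ← map_mul,
      div_eq_div_iff (algebraMap_MPoly_ne_zero (mul_ne_zero hb0 hc0))
        (algebraMap_ne_zero_of_pev_ne_zero hq), ← map_mul, ← map_mul] at heq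
    exact algebraMap_MPoly_injective heq
  set ω : MPoly →+* MPoly := (rename fun i => if i ∈ s then 0 else i : MPoly →ₐ[ℚ] MPoly).toRingHom
    with hω
  have hωq : ω q ≠ 0 := by
    intro h
    have : pev (fun _ => u 0) (ω q) = pev (fun _ => u 0) q :=
      RingHom.congr_fun (mpoly_ringHom_ext (φ := (pev fun _ => u 0).comp ω) (ψ := pev fun _ => u 0)
        fun i => by simp [hω]) q
    rw [h, map_zero] at this
    exact hq this.symm
  obtain ⟨x, hx⟩ := exists_eval_ne_zero (mul_ne_zero (mul_ne_zero hr0 hc0) hωq)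
  rw [map_mul, map_mul] at hx
  have hxr := left_ne_zero_of_mul (left_ne_zero_of_mul hx)
  have hxω := right_ne_zero_of_mul hx
  set φ : MPoly →+* MPoly := (aeval fun i => if i ∈ s then X i else C (x i) :
    MPoly →ₐ[ℚ] MPoly).toRingHom with hφ
  have hφs {p : MPoly} (hp : p ∈ supported ℚ s) : φ p = p :=
    mpoly_ringHom_eq_of_mem_supported (φ := φ) (ψ := RingHom.id _) (fun i hi => by simp [hφ, hi]) hp
  have hφc {p : MPoly} (hp : p ∈ supported ℚ sᶜ) : φ p = C (eval x p) :=
    mpoly_ringHom_eq_of_mem_supported (φ := φ) (ψ := C.comp (eval x))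
      (fun i hi => by simp [hφ, show i ∉ s from hi]) hp
  have hφq : pev (fun _ => u 0) (φ q) ≠ 0 := by
    intro h
    have h1 : pev (fun _ => u 0) (φ q) =
        algebraMap MPoly K (rename (fun _ => 0) (φ q)) := pev_u (φ q) fun _ => 0
    rw [h1, map_eq_zero_iff _ algebraMap_MPoly_injective] at h
    have h2 : eval x (rename (fun _ => 0) (φ q)) = eval x (ω q) :=
      RingHom.congr_fun (mpoly_ringHom_ext
        (φ := (eval x).comp ((rename fun _ => 0 : MPoly →ₐ[ℚ] MPoly).toRingHom.comp φ))
        (ψ := (eval x).comp ω)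
        fun i => by by_cases hi : i ∈ s <;> simp [hφ, hω, hi]) q
    rw [h, map_zero] at h2
    exact hxω h2.symm
  have hCr : (C (eval x r) : MPoly) ≠ 0 := by simpa using hxr
  refine ⟨φ p * C (eval x c), C (eval x r) * φ q, ?_, ?_⟩
  · rw [map_mul]
    refine mul_ne_zero ?_ hφq
    simpa [pev] using hxr
  · rw [div_eq_div_iff (algebraMap_MPoly_ne_zero hb0)
      (algebraMap_MPoly_ne_zero (mul_ne_zero hCr (ne_zero_of_pev_ne_zero hφq))),
      ← map_mul, ← map_mul]
    have := congrArg φ hpoly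
    simp only [map_mul] at this
    rw [hφs ha, hφs hb, hφc hr, hφc hc] at this
    congr 1
    linear_combination this

theorem IsFracIn.mono {s t : Set ℕ} (h : s ⊆ t) {f : K} (hf : IsFracIn s f) : IsFracIn t f := by
  obtain ⟨p, hp, q, hq, hq0, rfl⟩ := hf
  exact ⟨p, supported_mono h hp, q, supported_mono h hq, hq0, rfl⟩

theorem msub_zero (v : ℕ → K) : msub v 0 = 0 := by
  simpa using msub_algebraMap v 0

theorem pev_rename (v : ℕ → K) (ι : ℕ → ℕ) (p : MPoly) :
    pev v (rename ι p) = pev (fun k => v (ι k)) p :=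
  RingHom.congr_fun (mpoly_ringHom_ext (φ := (pev v).comp (rename ι : MPoly →ₐ[ℚ] MPoly).toRingHom)
    (ψ := pev fun k => v (ι k)) fun i => by simp) p

theorem renameHom_algebraMap {ι : ℕ → ℕ} (hι : Function.Injective ι) (p : MPoly) :
    renameHom hι (algebraMap MPoly K p) = algebraMap MPoly K (rename ι p) := by
  simp [renameHom]

theorem exists_frac (f : K) :
    ∃ p q : MPoly, q ≠ 0 ∧ f = algebraMap MPoly K p / algebraMap MPoly K q := by
  obtain ⟨p, q, hq, h⟩ := IsFractionRing.div_surjective (A := MPoly) f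
  exact ⟨p, q, nonZeroDivisors.ne_zero hq, h.symm⟩

theorem msub_u_eq_renameHom {ι : ℕ → ℕ} (hι : Function.Injective ι) (f : K) :
    msub (fun k => u (ι k)) f = renameHom hι f := by
  obtain ⟨p, q, hq, rfl⟩ := exists_frac f
  have : rename ι q ≠ 0 := (map_ne_zero_iff _ (rename_injective ι hι)).2 hq
  rw [msub_div (by rw [pev_u]; exact algebraMap_MPoly_ne_zero this), pev_u, pev_u, map_div₀,
    renameHom_algebraMap, renameHom_algebraMap]

theorem IsFracIn.renameHom {ι : ℕ → ℕ} (hι : Function.Injective ι) {s : Set ℕ} {f : K}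
    (hf : IsFracIn s f) : IsFracIn (ι '' s) (renameHom hι f) := by
  obtain ⟨p, hp, q, hq, hq0, rfl⟩ := hf
  have key {p : MPoly} (hp : p ∈ supported ℚ s) : rename ι p ∈ supported ℚ (ι '' s) := by
    rw [mem_supported] at hp ⊢
    intro i hi
    obtain ⟨j, hj, rfl⟩ := Finset.mem_image.1 (vars_rename ι p hi)
    exact ⟨j, hp hj, rfl⟩
  exact ⟨_, key hp, _, key hq, (map_ne_zero_iff _ (rename_injective ι hι)).2 hq0, by
    rw [map_div₀, renameHom_algebraMap, renameHom_algebraMap]⟩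

theorem RegularAt.renameHom {ι : ℕ → ℕ} (hι : Function.Injective ι) {v : ℕ → K} {f : K}
    (hf : RegularAt (fun k => v (ι k)) f) : RegularAt v (renameHom hι f) := by
  obtain ⟨p, q, hq, rfl⟩ := hf
  exact ⟨rename ι p, rename ι q, by rwa [pev_rename], by
    rw [map_div₀, renameHom_algebraMap, renameHom_algebraMap]⟩

theorem msub_renameHom {ι : ℕ → ℕ} (hι : Function.Injective ι) {v : ℕ → K} {f : K}
    (hf : RegularAt (fun k => v (ι k)) f) :
    msub v (renameHom hι f) = msub (fun k => v (ι k)) f := by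
  obtain ⟨p, q, hq, rfl⟩ := hf
  rw [msub_div hq, map_div₀, renameHom_algebraMap, renameHom_algebraMap,
    msub_div (by rwa [pev_rename]), pev_rename, pev_rename]

theorem regularAt_diag_of_renameHom {ι : ℕ → ℕ} (hι : Function.Injective ι) {f : K}
    (h : RegularAt (fun _ => u 0) (renameHom hι f)) : RegularAt (fun _ => u 0) f := by
  obtain ⟨r, s, hs0, rfl⟩ := exists_frac f
  obtain ⟨p, q, hq, heq⟩ := h
  have hι' (p : MPoly) : rename (Function.invFun ι) (rename ι p) = p := by
    rw [rename_rename, Function.invFun_comp hι, rename_id_apply]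
  have hq' : pev (fun _ => u 0) (rename (Function.invFun ι) q) ≠ 0 := by rwa [pev_rename]
  refine ⟨rename (Function.invFun ι) p, rename (Function.invFun ι) q, hq', ?_⟩
  rw [map_div₀, renameHom_algebraMap, renameHom_algebraMap, div_eq_div_iff
    (algebraMap_MPoly_ne_zero ((map_ne_zero_iff _ (rename_injective ι hι)).2 hs0))
    (algebraMap_ne_zero_of_pev_ne_zero hq), ← map_mul, ← map_mul] at heq
  have := congrArg (rename (Function.invFun ι)) (algebraMap_MPoly_injective heq)
  rw [map_mul, map_mul, hι', hι'] at this
  rw [div_eq_div_iff (algebraMap_MPoly_ne_zero hs0) (algebraMap_ne_zero_of_pev_ne_zero hq'),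
    ← map_mul, ← map_mul, this]

theorem msub_diag_renameHom {ι : ℕ → ℕ} (hι : Function.Injective ι) (f : K) :
    msub (fun _ => u 0) (renameHom hι f) = msub (fun _ => u 0) f := by
  by_cases h : RegularAt (fun _ => u 0) f
  · exact msub_renameHom hι h
  · rw [msub_of_not_regularAt h,
      msub_of_not_regularAt fun h' => h (regularAt_diag_of_renameHom hι h')]

/-- Restriction to the diagonal is multiplicative for functions in disjoint sets of variables,
even when one of them has a pole there. The factor `p / q` is a unit on the diagonal. -/
theorem msub_diag_mul_mul_div {s : Set ℕ} {f g : K} (hf : IsFracIn s f) (hg : IsFracIn sᶜ g)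
    {p q : MPoly} (hp : pev (fun _ => u 0) p ≠ 0) (hq : pev (fun _ => u 0) q ≠ 0) :
    msub (fun _ => u 0) (f * g * (algebraMap MPoly K p / algebraMap MPoly K q)) =
      msub (fun _ => u 0) f * msub (fun _ => u 0) g *
        (pev (fun _ => u 0) p / pev (fun _ => u 0) q) := by
  by_cases hf0 : f = 0
  · simp [hf0, msub_zero]
  by_cases hg0 : g = 0
  · simp [hg0, msub_zero]
  by_cases h : RegularAt (fun _ => u 0) f ∧ RegularAt (fun _ => u 0) g
  · rw [msub_mul (h.1.mul h.2) ⟨p, q, hq, rfl⟩, msub_mul h.1 h.2, msub_div hq]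
  · have hr : msub (fun _ => u 0) f * msub (fun _ => u 0) g = 0 := by
      rcases not_and_or.1 h with h | h
      · rw [msub_of_not_regularAt h, zero_mul]
      · rw [msub_of_not_regularAt h, mul_zero]
    rw [hr, zero_mul, msub_of_not_regularAt]
    intro hreg
    have hfg : RegularAt (fun _ => u 0) (f * g) := by
      have := hreg.mul (g := algebraMap MPoly K q / algebraMap MPoly K p) ⟨q, p, hp, rfl⟩
      rwa [mul_assoc, div_mul_div_cancel₀ (algebraMap_ne_zero_of_pev_ne_zero hq),
        div_self (algebraMap_ne_zero_of_pev_ne_zero hp), mul_one] at this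
    exact h ⟨hfg.of_mul_left hf hg hg0,
      (mul_comm f g ▸ hfg).of_mul_left hg (by rwa [compl_compl]) hf0⟩

theorem permExt_of_mem {n k : ℕ} (σ : Equiv.Perm (Fin n)) (h : 1 ≤ k ∧ k ≤ n) :
    permExt n σ k = (σ ⟨k - 1, by omega⟩ : ℕ) + 1 := by
  rw [permExt, dif_pos h]

theorem permExt_val_add_one {n : ℕ} (σ : Equiv.Perm (Fin n)) (i : Fin n) :
    permExt n σ (i + 1) = σ i + 1 := by
  rw [permExt_of_mem σ ⟨by omega, i.2⟩]
  simp

theorem permExt_of_not_mem {n k : ℕ} (σ : Equiv.Perm (Fin n)) (h : ¬ (1 ≤ k ∧ k ≤ n)) :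
    permExt n σ k = k := by
  rw [permExt, dif_neg h]

theorem permExt_mem {n k : ℕ} (σ : Equiv.Perm (Fin n)) (h : 1 ≤ k ∧ k ≤ n) :
    1 ≤ permExt n σ k ∧ permExt n σ k ≤ n := by
  rw [permExt_of_mem σ h]
  omega

theorem permExt_mul {n : ℕ} (σ τ : Equiv.Perm (Fin n)) (k : ℕ) :
    permExt n (σ * τ) k = permExt n σ (permExt n τ k) := by
  by_cases h : 1 ≤ k ∧ k ≤ n
  · rw [permExt_of_mem _ h, permExt_of_mem τ h, permExt_val_add_one, Equiv.Perm.mul_apply]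
  · rw [permExt_of_not_mem _ h, permExt_of_not_mem τ h, permExt_of_not_mem σ h]

theorem permExt_inv_permExt {n : ℕ} (σ : Equiv.Perm (Fin n)) (k : ℕ) :
    permExt n σ⁻¹ (permExt n σ k) = k := by
  rw [← permExt_mul, inv_mul_cancel]
  by_cases h : 1 ≤ k ∧ k ≤ n
  · rw [permExt_of_mem _ h, Equiv.Perm.one_apply]
    simp only
    omega
  · rw [permExt_of_not_mem _ h]

theorem permExt_injective {n : ℕ} (σ : Equiv.Perm (Fin n)) : Function.Injective (permExt n σ) :=
  Function.LeftInverse.injective (permExt_inv_permExt σ)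

@[simp]
theorem permExt_zero {n : ℕ} (σ : Equiv.Perm (Fin n)) : permExt n σ 0 = 0 :=
  permExt_of_not_mem σ (by omega)

@[to_additive]
theorem prod_Icc_permExt {M : Type*} [CommMonoid M] {n : ℕ} (σ : Equiv.Perm (Fin n))
    (w : ℕ → M) : ∏ k ∈ Icc 1 n, w (permExt n σ k) = ∏ k ∈ Icc 1 n, w k := by
  refine prod_nbij' (permExt n σ) (permExt n σ⁻¹) ?_ ?_ ?_ ?_ ?_
  · exact fun k hk => mem_Icc.2 (permExt_mem σ (mem_Icc.1 hk))
  · exact fun k hk => mem_Icc.2 (permExt_mem σ⁻¹ (mem_Icc.1 hk))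
  · exact fun k _ => permExt_inv_permExt σ k
  · exact fun k _ => by simpa using permExt_inv_permExt σ⁻¹ k
  · exact fun k _ => rfl

@[to_additive]
theorem prod_Icc_shift {M : Type*} [CommMonoid M] (m n : ℕ) (w : ℕ → M) :
    ∏ k ∈ Icc (m + 1) (m + n), w k = ∏ k ∈ Icc 1 n, w (k + m) := by
  refine (prod_nbij' (· + m) (· - m) ?_ ?_ ?_ ?_ ?_).symm
  all_goals simp only [mem_Icc]
  · omega
  · omega
  · omega
  · omega
  · simp

theorem prod_Icc_one_add {M : Type*} [CommMonoid M] (m n : ℕ) (w : ℕ → M) :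
    ∏ k ∈ Icc 1 (m + n), w k = (∏ k ∈ Icc 1 m, w k) * ∏ k ∈ Icc 1 n, w (k + m) := by
  induction n with
  | zero => simp
  | succ n ih =>
    rw [← add_assoc, prod_Icc_succ_top (by omega), ih, prod_Icc_succ_top (by omega), mul_assoc,
      show n + 1 + m = m + n + 1 by omega]

/-- The permutation of `m + n` letters acting by `α` on the first `m` and by `β` on the others. -/
def blockPerm {m n : ℕ} (α : Equiv.Perm (Fin m)) (β : Equiv.Perm (Fin n)) :
    Equiv.Perm (Fin (m + n)) :=
  finSumFinEquiv.permCongr (Equiv.sumCongr α β)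

theorem permExt_blockPerm_left {m n k : ℕ} (α : Equiv.Perm (Fin m)) (β : Equiv.Perm (Fin n))
    (h : 1 ≤ k ∧ k ≤ m) : permExt (m + n) (blockPerm α β) k = permExt m α k := by
  obtain ⟨i, rfl⟩ : ∃ i : Fin m, k = i + 1 := ⟨⟨k - 1, by omega⟩, by simp only; omega⟩
  have := permExt_val_add_one (blockPerm α β) (Fin.castAdd n i)
  rw [Fin.val_castAdd] at this
  rw [this, permExt_val_add_one]
  simp [blockPerm, Equiv.permCongr_apply]

theorem permExt_blockPerm_right {m n k : ℕ} (α : Equiv.Perm (Fin m)) (β : Equiv.Perm (Fin n))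
    (h : 1 ≤ k ∧ k ≤ n) : permExt (m + n) (blockPerm α β) (k + m) = permExt n β k + m := by
  obtain ⟨i, rfl⟩ : ∃ i : Fin n, k = i + 1 := ⟨⟨k - 1, by omega⟩, by simp only; omega⟩
  have := permExt_val_add_one (blockPerm α β) (Fin.natAdd m i)
  rw [Fin.val_natAdd] at this
  rw [show (i : ℕ) + 1 + m = m + i + 1 by omega, this, permExt_val_add_one]
  simp [blockPerm, Equiv.permCongr_apply]
  omega

theorem card_mul_sum_perm_apply {ι R : Type*} [Fintype ι] [DecidableEq ι] [CommSemiring R]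
    (x : ι → R) (i : ι) :
    (Fintype.card ι : R) * ∑ σ : Equiv.Perm ι, x (σ i) =
      ((Fintype.card ι).factorial : R) * ∑ j, x j := by
  have h (j : ι) : ∑ σ : Equiv.Perm ι, x (σ j) = ∑ σ : Equiv.Perm ι, x (σ i) :=
    Fintype.sum_equiv (Equiv.mulRight (Equiv.swap i j)) _ _ fun σ => by simp
  have h1 : ∑ j, ∑ σ : Equiv.Perm ι, x (σ j) =
      (Fintype.card ι : R) * ∑ σ : Equiv.Perm ι, x (σ i) := by
    simp [h]
  have h2 (σ : Equiv.Perm ι) : ∑ j, x (σ j) = ∑ j, x j := Equiv.sum_comp σ x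
  rw [← h1, sum_comm]
  simp [h2, Fintype.card_perm]

theorem mul_sum_u_permExt {n k : ℕ} (hk : 1 ≤ k ∧ k ≤ n) :
    (n : K) * ∑ σ : Equiv.Perm (Fin n), u (permExt n σ k) = (n.factorial : K) * usum 1 n := by
  have h := card_mul_sum_perm_apply (fun i : Fin n => u (i + 1)) ⟨k - 1, by omega⟩
  have hu : usum 1 n = ∑ i : Fin n, u (i + 1) := by
    rw [Fin.sum_univ_eq_sum_range (fun i => u (i + 1)), usum, range_eq_Ico, sum_Ico_add']
    rfl
  rw [Fintype.card_fin, ← hu] at h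
  simpa only [permExt_of_mem _ hk] using h

theorem usum_one_ne_zero {n : ℕ} (hn : 1 ≤ n) : usum 1 n ≠ 0 := by
  have h : usum 1 n = algebraMap MPoly K (∑ k ∈ Icc 1 n, X k) := by simp [usum, u]
  rw [h]
  refine algebraMap_MPoly_ne_zero fun h0 => ?_
  have := congrArg (eval fun _ => (1 : ℚ)) h0
  simp at this
  omega

theorem u_zero_ne_zero : u 0 ≠ 0 :=
  algebraMap_MPoly_ne_zero (X_ne_zero 0)

theorem add_right_injective_nat (m : ℕ) : Function.Injective fun k : ℕ => k + m :=
  fun _ _ h => Nat.add_right_cancel h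

theorem factorial_ne_zero_K (n : ℕ) : (n.factorial : K) ≠ 0 :=
  Nat.cast_ne_zero.2 n.factorial_ne_zero

/-- The vegetal identity of `f`, transported to the variables `u (ι 1), …, u (ι m)`. -/
theorem IsVegetal.prod_mul_sum {m : ℕ} {f : K} (hfv : IsVegetal m f)
    {ι : ℕ → ℕ} (hι : Function.Injective ι) (h0 : ∀ i, ι i = 0 ↔ i = 0) :
    (∏ k ∈ Icc 1 m, u (ι k)) * ∑ α : Equiv.Perm (Fin m),
      msub (fun k => u 0 * u (ι (permExt m α k))) f =
    (m.factorial : K) * msub (fun _ => u 0) f := by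
  have h := congrArg (renameHom hι) hfv
  simpa only [map_mul, map_prod, map_sum, map_natCast, map_msub, renameHom_u,
    (h0 0).2 rfl] using h

theorem pev_sum_X (v : ℕ → K) (A : Finset ℕ) : pev v (∑ k ∈ A, X k) = ∑ k ∈ A, v k := by
  simp

theorem algebraMap_sum_X (A : Finset ℕ) :
    algebraMap MPoly K (∑ k ∈ A, X k) = ∑ k ∈ A, u k := by
  simp [u]

theorem sum_perm_eq_sum_block {m n : ℕ} (H : Equiv.Perm (Fin (m + n)) → K) :
    (m.factorial : K) * n.factorial * ∑ σ, H σ =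
      ∑ σ, ∑ α : Equiv.Perm (Fin m), ∑ β : Equiv.Perm (Fin n), H (σ * blockPerm α β) := by
  have h (α : Equiv.Perm (Fin m)) (β : Equiv.Perm (Fin n)) :
      ∑ σ, H (σ * blockPerm α β) = ∑ σ, H σ :=
    Equiv.sum_comp (Equiv.mulRight (blockPerm α β)) H
  rw [sum_comm]
  simp_rw [sum_comm (s := (univ : Finset (Equiv.Perm (Fin (m + n))))), h]
  simp [Fintype.card_perm, mul_assoc]

/-- The product of vegetal functions in disjoint variables, weighted by `∑ k ∈ A, u k / u_{1..m+n}`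
for a set of indices `A` stable under the Young subgroup `S_m × S_n`, is vegetal. -/
theorem isVegetal_mul_sum_div {m n : ℕ} {f g : K} (hf : f ∈ Mould m)
    (hg : g ∈ Mould n) (hfv : IsVegetal m f) (hgv : IsVegetal n g) {A : Finset ℕ}
    (hA : A ⊆ Icc 1 (m + n)) (hA0 : A.Nonempty)
    (hAinv : ∀ (α : Equiv.Perm (Fin m)) (β : Equiv.Perm (Fin n)) (w : ℕ → K),
      ∑ k ∈ A, w (permExt (m + n) (blockPerm α β) k) = ∑ k ∈ A, w k) :
    IsVegetal (m + n) (f * msub (shiftSub m) g * (∑ k ∈ A, u k) / usum 1 (m + n)) := by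
  have hN : 1 ≤ m + n := by
    obtain ⟨k, hk⟩ := hA0
    have := mem_Icc.1 (hA hk)
    omega
  have hN0 : ((m + n : ℕ) : K) ≠ 0 := Nat.cast_ne_zero.2 (by omega)
  have hU := usum_one_ne_zero hN
  replace hf := isFracIn_of_mem_Mould hf
  replace hg := isFracIn_of_mem_Mould hg
  have hs := add_right_injective_nat m
  have hg' : msub (shiftSub m) g = renameHom hs g := msub_u_eq_renameHom hs g
  rw [hg', mul_div_assoc]
  have hquot : (∑ k ∈ A, u k) / usum 1 (m + n) = algebraMap MPoly K (∑ k ∈ A, X k) /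
      algebraMap MPoly K (∑ k ∈ Icc 1 (m + n), X k) := by
    rw [algebraMap_sum_X, algebraMap_sum_X, usum]
  set F : Equiv.Perm (Fin (m + n)) → K := fun σ =>
    msub (fun k => u 0 * u (permExt (m + n) σ k)) f
  set G : Equiv.Perm (Fin (m + n)) → K := fun σ =>
    msub (fun k => u 0 * u (permExt (m + n) σ (k + m))) g
  set L : Equiv.Perm (Fin (m + n)) → K := fun σ => ∑ k ∈ A, u (permExt (m + n) σ k) with hL
  set d : K := msub (fun _ => u 0) f
  set e : K := msub (fun _ => u 0) g
  have hfreg (σ : Equiv.Perm (Fin (m + n))) (q) (hq : q ∈ supported ℚ (Set.Icc 1 m))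
      (hq0 : q ≠ 0) : pev (fun k => u 0 * u (permExt (m + n) σ k)) q ≠ 0 := by
    refine pev_scaled_ne_zero (permExt_injective σ).injOn (fun i hi => ?_) hq hq0
    have := permExt_mem σ (k := i) ⟨hi.1, hi.2.trans (by omega)⟩
    omega
  have hgreg (σ : Equiv.Perm (Fin (m + n))) (q) (hq : q ∈ supported ℚ (Set.Icc 1 n))
      (hq0 : q ≠ 0) : pev (fun k => u 0 * u (permExt (m + n) σ (k + m))) q ≠ 0 := by
    refine pev_scaled_ne_zero (ι := fun k => permExt (m + n) σ (k + m))
      ((permExt_injective σ).comp hs).injOn (fun i hi => ?_) hq hq0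
    have := permExt_mem σ (k := i + m) ⟨le_add_right hi.1, by have := hi.2; omega⟩
    omega
  have hterm (σ : Equiv.Perm (Fin (m + n))) :
      msub (fun k => u 0 * u (permExt (m + n) σ k))
        (f * renameHom hs g * ((∑ k ∈ A, u k) / usum 1 (m + n))) =
      F σ * G σ * L σ / usum 1 (m + n) := by
    have hq : pev (fun k => u 0 * u (permExt (m + n) σ k)) (∑ k ∈ Icc 1 (m + n), X k) =
        u 0 * usum 1 (m + n) := by
      rw [pev_sum_X, ← mul_sum, sum_Icc_permExt, usum]
    have hq0 : pev (fun k => u 0 * u (permExt (m + n) σ k)) (∑ k ∈ Icc 1 (m + n), X k) ≠ 0 := by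
      rw [hq]
      exact mul_ne_zero u_zero_ne_zero hU
    have hgr : RegularAt (fun k => u 0 * u (permExt (m + n) σ (k + m))) g :=
      hg.regularAt (hgreg σ)
    have hfr := hf.regularAt (hfreg σ)
    rw [hquot, msub_mul (hfr.mul (hgr.renameHom hs
        (v := fun k => u 0 * u (permExt (m + n) σ k)))) ⟨_, _, hq0, rfl⟩,
      msub_mul hfr (hgr.renameHom hs (v := fun k => u 0 * u (permExt (m + n) σ k))),
      msub_renameHom hs (v := fun k => u 0 * u (permExt (m + n) σ k)) hgr,
      msub_div hq0, hq, pev_sum_X, ← mul_sum, mul_div_mul_left _ _ u_zero_ne_zero, mul_div_assoc]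
  have hdiag : msub (fun _ => u 0) (f * renameHom hs g * ((∑ k ∈ A, u k) / usum 1 (m + n))) =
      d * e * (#A / (m + n : ℕ)) := by
    have hpev (B : Finset ℕ) : pev (fun _ => u 0) (∑ k ∈ B, X k) = #B * u 0 := by
      rw [pev_sum_X, sum_const, nsmul_eq_mul]
    have hcard : #(Icc 1 (m + n)) = m + n := by simp
    have hdisj : IsFracIn (Set.Icc 1 m)ᶜ (renameHom hs g) := by
      refine (hg.renameHom hs).mono ?_
      rintro _ ⟨k, hk, rfl⟩ ⟨-, h⟩
      have := hk.1
      simp only at h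
      omega
    rw [hquot, msub_diag_mul_mul_div hf hdisj, msub_diag_renameHom, hpev, hpev, hcard,
      mul_div_mul_right _ _ u_zero_ne_zero]
    · rw [hpev]
      exact mul_ne_zero (Nat.cast_ne_zero.2 hA0.card_pos.ne') u_zero_ne_zero
    · rw [hpev, hcard]
      exact mul_ne_zero hN0 u_zero_ne_zero
  have hFblock (σ) (α : Equiv.Perm (Fin m)) (β : Equiv.Perm (Fin n)) :
      F (σ * blockPerm α β) = msub (fun k => u 0 * u (permExt (m + n) σ (permExt m α k))) f :=
    msub_congr hf (fun i hi => by rw [permExt_mul, permExt_blockPerm_left α β hi]) (hfreg _)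
  have hGblock (σ) (α : Equiv.Perm (Fin m)) (β : Equiv.Perm (Fin n)) :
      G (σ * blockPerm α β) =
        msub (fun k => u 0 * u (permExt (m + n) σ (permExt n β k + m))) g :=
    msub_congr hg (fun i hi => by rw [permExt_mul, permExt_blockPerm_right α β hi]) (hgreg _)
  have hLblock (σ) (α : Equiv.Perm (Fin m)) (β : Equiv.Perm (Fin n)) :
      L (σ * blockPerm α β) = L σ := by
    simp only [hL, permExt_mul]
    exact hAinv α β fun k => u (permExt (m + n) σ k)
  have hsumF (σ : Equiv.Perm (Fin (m + n))) : (∏ k ∈ Icc 1 m, u (permExt (m + n) σ k)) *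
      ∑ α : Equiv.Perm (Fin m), msub (fun k => u 0 * u (permExt (m + n) σ (permExt m α k))) f =
      m.factorial * d :=
    hfv.prod_mul_sum (permExt_injective σ) fun i =>
      ⟨fun h => permExt_injective σ (by rw [h, permExt_zero]), fun h => by rw [h, permExt_zero]⟩
  have hsumG (σ : Equiv.Perm (Fin (m + n))) :
      (∏ k ∈ Icc 1 n, u (permExt (m + n) σ (k + m))) * ∑ β : Equiv.Perm (Fin n),
        msub (fun k => u 0 * u (permExt (m + n) σ (permExt n β k + m))) g =
      n.factorial * e := by
    set ι : ℕ → ℕ := fun k => if k = 0 then 0 else permExt (m + n) σ (k + m) with hι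
    have hne (k) (hk : k ≠ 0) : permExt (m + n) σ (k + m) ≠ 0 := fun h => by
      have := permExt_injective σ (h.trans (permExt_zero σ).symm)
      omega
    have hι0 (k) (hk : k ≠ 0) : ι k = permExt (m + n) σ (k + m) := if_neg hk
    have hιz (i) : ι i = 0 ↔ i = 0 :=
      ⟨fun h => by_contra fun hi => hne i hi (hι0 i hi ▸ h), fun h => if_pos h⟩
    have hιinj : Function.Injective ι := fun i j h => by
      by_cases hi : i = 0
      · rw [(hιz i).2 hi] at h
        rw [hi, (hιz j).1 h.symm]
      · have hj : j ≠ 0 := fun hj => hi ((hιz i).1 (h.trans ((hιz j).2 hj)))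
        rw [hι0 i hi, hι0 j hj] at h
        exact hs (permExt_injective σ h)
    rw [← hgv.prod_mul_sum hιinj hιz]
    congr 1
    · refine prod_congr rfl fun k hk => ?_
      rw [hι0 k (by have := mem_Icc.1 hk; omega)]
    · refine sum_congr rfl fun β _ => ?_
      rw [← hGblock σ 1 β]
      refine msub_congr hg (fun i hi => ?_) (hgreg _)
      have := permExt_mem β hi
      rw [permExt_mul, permExt_blockPerm_right 1 β hi, hι0 _ (by omega)]
  have hmain : (∏ k ∈ Icc 1 (m + n), u k) * ∑ σ, F σ * G σ * L σ = d * e * ∑ σ, L σ := by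
    refine mul_left_cancel₀ (mul_ne_zero (factorial_ne_zero_K m) (factorial_ne_zero_K n)) ?_
    rw [mul_left_comm, sum_perm_eq_sum_block, mul_sum, mul_sum, mul_sum]
    refine sum_congr rfl fun σ _ => ?_
    simp only [hFblock, hGblock, hLblock, ← sum_mul, ← mul_sum]
    rw [← prod_Icc_permExt σ, prod_Icc_one_add]
    linear_combination L σ * (∏ k ∈ Icc 1 n, u (permExt (m + n) σ (k + m))) *
      (∑ β : Equiv.Perm (Fin n),
        msub (fun k => u 0 * u (permExt (m + n) σ (permExt n β k + m))) g) * hsumF σ +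
      L σ * (m.factorial * d) * hsumG σ
  have hsumL : ((m + n : ℕ) : K) * ∑ σ, L σ = #A * ((m + n).factorial * usum 1 (m + n)) := by
    rw [sum_comm, mul_sum, sum_congr rfl fun k hk => mul_sum_u_permExt (mem_Icc.1 (hA hk)),
      sum_const, nsmul_eq_mul]
  rw [IsVegetal, hdiag, sum_congr rfl fun σ _ => hterm σ, ← sum_div, ← mul_div_assoc, hmain,
    ← mul_div_assoc, ← mul_div_assoc, div_eq_div_iff hU hN0]
  linear_combination d * e * hsumL

/-- if `f ∈ Mould m` and `g ∈ Mould n` are vegetal, then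
`f ≻ g` and `f ≺ g` are vegetal elements of `Mould (m+n)`. -/
theorem vegetal_dendriform (m n : ℕ) (hm : 1 ≤ m) (hn : 1 ≤ n)
    (f g : K) (hf : f ∈ Mould m) (hg : g ∈ Mould n)
    (hfv : IsVegetal m f) (hgv : IsVegetal n g) :
    IsVegetal (m + n) (dsucc m n f g) ∧ IsVegetal (m + n) (dprec m n f g) := by
  constructor
  · refine isVegetal_mul_sum_div hf hg hfv hgv (A := Icc (m + 1) (m + n))
      (Icc_subset_Icc_left (by omega)) (nonempty_Icc.2 (by omega)) fun α β w => ?_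
    rw [sum_Icc_shift, sum_Icc_shift, ← sum_Icc_permExt β fun k => w (k + m)]
    exact sum_congr rfl fun k hk => by rw [permExt_blockPerm_right α β (mem_Icc.1 hk)]
  · refine isVegetal_mul_sum_div hf hg hfv hgv (A := Icc 1 m)
      (Icc_subset_Icc_right (by omega)) (nonempty_Icc.2 hm) fun α β w => ?_
    rw [← sum_Icc_permExt α w]
    exact sum_congr rfl fun k hk => by rw [permExt_blockPerm_left α β (mem_Icc.1 hk)]


end MouldOperad
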